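/- arXiv:1303.4225 — 2 statements merged into one kernel-verified Lean document; each statement's English description precedes it below -/
import Mathlib

section
/- Suppose (u₀, u₁) ≢ 0. Then the set A is nonempty, and the quantity τ₀ = inf({τ(s) : s ∈ A} ∪ {2/F₀''(s) : s ∈ B}) is a finite positive real number, i.e., 0 < τ₀ < ∞. -/
open Set Filter MeasureTheory

noncomputable section

/-- `F₀(s) = (1/2)(s u₀(s) + ∫_s^∞ ρ u₁(ρ) dρ)` -/
def F0 (u₀ u₁ : ℝ → ℝ) (s : ℝ) : ℝ := (1 / 2) * (s * u₀ s + ∫ ρ in Set.Ioi s, ρ * u₁ ρ)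

/-- `τ(s) = (2/F₀'(s)) ln (F₀''(s)/(F₀''(s) - F₀'(s)))` -/
def tauOf (u₀ u₁ : ℝ → ℝ) (s : ℝ) : ℝ :=
  (2 / deriv (F0 u₀ u₁) s) *
    Real.log (deriv (deriv (F0 u₀ u₁)) s / (deriv (deriv (F0 u₀ u₁)) s - deriv (F0 u₀ u₁) s))

def setA (M : ℝ) (u₀ u₁ : ℝ → ℝ) : Set ℝ :=
  {s | s ∈ Set.Ioo (-M) M ∧ deriv (F0 u₀ u₁) s ≠ 0 ∧
    0 < deriv (deriv (F0 u₀ u₁)) s / (deriv (deriv (F0 u₀ u₁)) s - deriv (F0 u₀ u₁) s) ∧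
    0 < tauOf u₀ u₁ s}

def setB (M : ℝ) (u₀ u₁ : ℝ → ℝ) : Set ℝ :=
  {s | s ∈ Set.Ioo (-M) M ∧ deriv (F0 u₀ u₁) s = 0 ∧ 0 < deriv (deriv (F0 u₀ u₁)) s}

/-- `τ₀ = min { min_{s ∈ A} τ(s), min_{s ∈ B} 2/F₀''(s) }` -/
def tau0 (M : ℝ) (u₀ u₁ : ℝ → ℝ) : ℝ :=
  sInf (tauOf u₀ u₁ '' setA M u₀ u₁ ∪
    (fun s => 2 / deriv (deriv (F0 u₀ u₁)) s) '' setB M u₀ u₁)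

/-- A function that vanishes for `M < |s|` has a derivative that vanishes there. -/
theorem deriv_eq_zero_of_lt_abs {M : ℝ} {f : ℝ → ℝ} (hf : ∀ s, M < |s| → f s = 0)
    {s : ℝ} (hs : M < |s|) : deriv f s = 0 := by
  have h : f =ᶠ[nhds s] fun _ => 0 := by
    filter_upwards [(isOpen_lt continuous_const continuous_abs).mem_nhds hs] with x hx
    exact hf x hx
  rw [h.deriv_eq, deriv_const]

theorem eq_zero_at_right_endpoint {M : ℝ} {f : ℝ → ℝ} (hc : Continuous f)
    (hf : ∀ s, M < |s| → f s = 0) : f M = 0 := by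
  have hcl : IsClosed {x | f x = 0} := isClosed_eq hc continuous_const
  have hsub : Ioi M ⊆ {x | f x = 0} := fun x hx => hf x (lt_of_lt_of_le hx (le_abs_self x))
  have := closure_minimal hsub hcl
  rw [closure_Ioi] at this
  exact this self_mem_Ici

theorem eq_zero_at_left_endpoint {M : ℝ} {f : ℝ → ℝ} (hc : Continuous f)
    (hf : ∀ s, M < |s| → f s = 0) : f (-M) = 0 :=
  eq_zero_at_right_endpoint (f := fun x => f (-x)) (hc.comp continuous_neg)
    fun s hs => hf (-s) (by rwa [abs_neg])

/-- A differentiable function going from a nonpositive to a positive value is somewhere both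
positive and increasing. -/
theorem exists_pos_and_deriv_pos {h : ℝ → ℝ} (hd : Differentiable ℝ h) {a b : ℝ} (hab : a ≤ b)
    (ha : h a ≤ 0) (hb : 0 < h b) : ∃ x ∈ Ioo a b, 0 < h x ∧ 0 < deriv h x := by
  have hcomp : IsCompact (Icc a b ∩ {x | h x ≤ 0}) :=
    isCompact_Icc.inter_right (isClosed_le hd.continuous continuous_const)
  obtain ⟨c, ⟨⟨hac, hcb⟩, hc⟩, hmax⟩ := hcomp.exists_isGreatest ⟨a, left_mem_Icc.2 hab, ha⟩
  have hc : h c ≤ 0 := hc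
  have hcb' : c < b := lt_of_le_of_ne hcb fun hEq => by rw [hEq] at hc; linarith
  obtain ⟨x, hx, hslope⟩ := exists_deriv_eq_slope h hcb' hd.continuous.continuousOn
    hd.differentiableOn
  refine ⟨x, ⟨hac.trans_lt hx.1, hx.2⟩, ?_, ?_⟩
  · by_contra! hneg
    exact absurd (hmax ⟨⟨hac.trans hx.1.le, hx.2.le⟩, hneg⟩) (not_le.2 hx.1)
  · rw [hslope]
    exact div_pos (by linarith) (by linarith)

/-- A nonzero `C¹` function supported in `[-M, M]` has a point where it is nonzero and where its
derivative exceeds both the function and zero. -/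
theorem exists_ne_zero_and_lt_deriv {M : ℝ} {f : ℝ → ℝ} (hd : Differentiable ℝ f)
    (hf : ∀ s, M < |s| → f s = 0) {s : ℝ} (hs : f s ≠ 0) :
    ∃ x ∈ Ioo (-M) M, f x ≠ 0 ∧ f x < deriv f x ∧ 0 < deriv f x := by
  have hsM : |s| ≤ M := by
    by_contra! h
    exact hs (hf s h)
  obtain ⟨h1, h2⟩ := abs_le.1 hsM
  rcases lt_or_gt_of_ne hs with hneg | hpos
  · obtain ⟨x, hx, hx1, hx2⟩ := exists_pos_and_deriv_pos (h := fun x => -f (-x))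
      (hd.comp differentiable_neg).neg (a := -M) (b := -s) (by linarith)
      (by simp [eq_zero_at_right_endpoint hd.continuous hf]) (by simpa using hneg)
    have hder : deriv (fun x => -f (-x)) x = deriv f (-x) := by
      rw [deriv.fun_neg, deriv_comp_neg, neg_neg]
    rw [hder] at hx2
    refine ⟨-x, ⟨by linarith [hx.2], by linarith [hx.1]⟩, ?_, ?_, hx2⟩ <;> grind
  · have hh : ∀ x, HasDerivAt (fun x => Real.exp (-x) * f x)
        (Real.exp (-x) * (deriv f x - f x)) x := fun x =>
      (((hasDerivAt_neg x).exp).mul (hd x).hasDerivAt).congr_deriv (by ring)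
    obtain ⟨x, hx, hx1, hx2⟩ := exists_pos_and_deriv_pos
      (h := fun x => Real.exp (-x) * f x) (fun x => (hh x).differentiableAt) h1
      (by simp [eq_zero_at_left_endpoint hd.continuous hf]) (by positivity)
    rw [(hh x).deriv] at hx2
    have e := Real.exp_pos (-x)
    have hx1' := pos_of_mul_pos_right hx1 e.le
    have hx2' := pos_of_mul_pos_right hx2 e.le
    exact ⟨x, ⟨hx.1, by linarith [hx.2]⟩, hx1'.ne', by linarith, by linarith⟩

theorem two_div_mul_log_pos {f g : ℝ} (hf : f ≠ 0) (hfg : f < g) (hg : 0 < g) :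
    0 < 2 / f * Real.log (g / (g - f)) := by
  have hgf : 0 < g - f := by linarith
  rcases lt_or_gt_of_ne hf with hneg | hpos
  · exact mul_pos_of_neg_of_neg (div_neg_of_pos_of_neg two_pos hneg)
      (Real.log_neg (by positivity) ((div_lt_one hgf).2 (by linarith)))
  · exact mul_pos (by positivity) (Real.log_pos ((one_lt_div hgf).2 (by linarith)))

theorem one_div_le_two_div_mul_log {f g K : ℝ} (hf : f ≠ 0) (hw : 0 < g / (g - f))
    (hτ : 0 < 2 / f * Real.log (g / (g - f))) (hfK : |f| ≤ K) (hgK : |g| ≤ K) :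
    1 / K ≤ 2 / f * Real.log (g / (g - f)) := by
  have hK : 0 < K := (abs_pos.2 hf).trans_le hfK
  rcases lt_or_gt_of_ne hf with hneg | hpos
  · have hlog : Real.log (g / (g - f)) < 0 := by
      by_contra! h
      exact absurd hτ (not_lt.2 (mul_nonpos_of_nonpos_of_nonneg
        (div_neg_of_pos_of_neg two_pos hneg).le h))
    have hw1 : g / (g - f) < 1 := (Real.log_neg_iff hw).1 hlog
    have hgf : 0 < g - f := by
      by_contra! h
      rcases h.lt_or_eq with h | h
      · rw [div_lt_one_of_neg h] at hw1
        linarith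
      · simp [h] at hw
    have hle := Real.log_le_sub_one_of_pos hw
    have hEq : g / (g - f) - 1 = f / (g - f) := by field_simp; ring
    rw [hEq] at hle
    calc 1 / K = 2 / (2 * K) := by field_simp
      _ ≤ 2 / (g - f) := by
        gcongr
        linarith [le_abs_self g, neg_le_abs f]
      _ = 2 / f * (f / (g - f)) := by field_simp
      _ ≤ _ := mul_le_mul_of_nonpos_left hle (div_neg_of_pos_of_neg two_pos hneg).le
  · have hlog : 0 < Real.log (g / (g - f)) := pos_of_mul_pos_right hτ (by positivity)
    have hw1 : 1 < g / (g - f) := (Real.log_pos_iff hw.le).1 hlog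
    have hgf : 0 < g - f := by
      by_contra! h
      rcases h.lt_or_eq with h | h
      · rw [one_lt_div_of_neg h] at hw1
        linarith
      · simp [h] at hw
    have hg : 0 < g := by linarith
    have hle := Real.one_sub_inv_le_log_of_pos hw
    have hEq : 1 - (g / (g - f))⁻¹ = f / g := by field_simp; ring
    rw [hEq] at hle
    calc 1 / K ≤ 2 / g := by
          rw [div_le_div_iff₀ hK hg]
          linarith [le_abs_self g]
      _ = 2 / f * (f / g) := by field_simp
      _ ≤ _ := by gcongr

theorem hasDerivAt_integral_Ioi {φ : ℝ → ℝ} (hc : Continuous φ) (hi : Integrable φ) (s : ℝ) :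
    HasDerivAt (fun s => ∫ ρ in Ioi s, φ ρ) (-φ s) s := by
  have hEq : (fun s => ∫ ρ in Ioi s, φ ρ) = fun s => (∫ ρ in Ioi 0, φ ρ) - ∫ ρ in 0..s, φ ρ := by
    funext s
    have := intervalIntegral.integral_Ioi_sub_Ioi' (hi.integrableOn (s := Ioi 0))
      (hi.integrableOn (s := Ioi s))
    linarith
  rw [hEq]
  exact (intervalIntegral.integral_hasDerivAt_right (hc.intervalIntegrable _ _)
    (hc.stronglyMeasurableAtFilter _ _) hc.continuousAt).const_sub _

theorem deriv_F0 {M : ℝ} {u₀ u₁ : ℝ → ℝ} (hu₀ : Differentiable ℝ u₀) (hu₁ : Continuous u₁)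
    (hsupp₁ : ∀ s, M < |s| → u₁ s = 0) :
    deriv (F0 u₀ u₁) = fun s => (1 / 2) * (u₀ s + s * deriv u₀ s - s * u₁ s) := by
  have hc : Continuous fun ρ => ρ * u₁ ρ := continuous_id.mul hu₁
  have hcs : HasCompactSupport fun ρ => ρ * u₁ ρ :=
    HasCompactSupport.intro (isCompact_Icc (a := -M) (b := M)) fun s hs => by
      have : M < |s| := by
        by_contra! h
        exact hs (abs_le.1 h)
      simp [hsupp₁ s this]
  funext s
  have h := (((hasDerivAt_id s).mul (hu₀ s).hasDerivAt).add
    (hasDerivAt_integral_Ioi hc (hc.integrable_of_hasCompactSupport hcs) s)).const_mul (1 / 2)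
  refine HasDerivAt.deriv (f := F0 u₀ u₁) (h.congr_deriv ?_)
  simp only [id]
  ring

theorem eq_zero_of_forall_mul_eq_zero {u : ℝ → ℝ} (hc : Continuous u) (h : ∀ s, s * u s = 0) :
    u = 0 :=
  hc.ext_on (dense_compl_singleton (0 : ℝ)) continuous_const fun s hs =>
    (mul_eq_zero.1 (h s)).resolve_left hs

theorem exists_deriv_F0_ne_zero {M : ℝ} {u₀ u₁ : ℝ → ℝ} (hu₀ : Differentiable ℝ u₀)
    (hu₁ : Continuous u₁) (heven₀ : ∀ s, u₀ (-s) = u₀ s) (heven₁ : ∀ s, u₁ (-s) = u₁ s)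
    (hsupp₀ : ∀ s, M < |s| → u₀ s = 0) (hsupp₁ : ∀ s, M < |s| → u₁ s = 0)
    (hne : u₀ ≠ 0 ∨ u₁ ≠ 0) : ∃ s, deriv (F0 u₀ u₁) s ≠ 0 := by
  by_contra! hz
  simp only [deriv_F0 hu₀ hu₁ hsupp₁] at hz
  have hodd : ∀ s, deriv u₀ (-s) = -deriv u₀ s := fun s => by
    have h := deriv_comp_neg u₀ s
    rw [show (fun x => u₀ (-x)) = u₀ from funext heven₀] at h
    linarith
  have key : ∀ s, u₀ s + s * deriv u₀ s = 0 ∧ s * u₁ s = 0 := fun s => by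
    have h1 := hz s
    have h2 := hz (-s)
    rw [heven₀, heven₁, hodd] at h2
    constructor <;> linarith
  have hu₁0 : u₁ = 0 := eq_zero_of_forall_mul_eq_zero hu₁ fun s => (key s).2
  have hu₀0 : u₀ = 0 := eq_zero_of_forall_mul_eq_zero hu₀.continuous fun s => by
    have hder : ∀ x, deriv (fun s => s * u₀ s) x = 0 := fun x => by
      have h := ((hasDerivAt_id x).mul (hu₀ x).hasDerivAt).deriv
      simp only [id, one_mul] at h
      exact h.trans (key x).1
    have hconst := is_const_of_deriv_eq_zero (differentiable_id.mul hu₀) hder s (|M| + 1)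
    have habs : M < |(|M| + 1)| := by
      rw [abs_of_nonneg (by positivity)]
      linarith [le_abs_self M]
    simpa [hsupp₀ _ habs] using hconst
  exact hne.elim (· hu₀0) (· hu₁0)

theorem tau0_pos_finite (M : ℝ) (hM : 0 < M) (u₀ u₁ : ℝ → ℝ)
    (hu₀ : ContDiff ℝ (⊤ : ℕ∞) u₀) (hu₁ : ContDiff ℝ (⊤ : ℕ∞) u₁)
    (heven₀ : ∀ s, u₀ (-s) = u₀ s) (heven₁ : ∀ s, u₁ (-s) = u₁ s)
    (hsupp₀ : ∀ s, M < |s| → u₀ s = 0) (hsupp₁ : ∀ s, M < |s| → u₁ s = 0)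
    (hne : u₀ ≠ 0 ∨ u₁ ≠ 0) :
    (setA M u₀ u₁).Nonempty ∧ 0 < tau0 M u₀ u₁ := by
  have hd₀ : Differentiable ℝ u₀ := hu₀.differentiable (by simp)
  have hc₁ : Continuous u₁ := hu₁.continuous
  have hF := deriv_F0 hd₀ hc₁ hsupp₁
  have hsm : ContDiff ℝ 1 (deriv (F0 u₀ u₁)) := by
    rw [hF]
    have h0 : ContDiff ℝ 1 u₀ := hu₀.of_le (by exact_mod_cast le_top)
    have h1 : ContDiff ℝ 1 u₁ := hu₁.of_le (by exact_mod_cast le_top)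
    have h0' : ContDiff ℝ 1 (deriv u₀) :=
      (contDiff_infty_iff_deriv.1 hu₀).2.of_le (by exact_mod_cast le_top)
    fun_prop
  have hvan : ∀ s, M < |s| → deriv (F0 u₀ u₁) s = 0 := fun s hs => by
    simp [hF, hsupp₀ s hs, hsupp₁ s hs, deriv_eq_zero_of_lt_abs hsupp₀ hs]
  have hdiff : Differentiable ℝ (deriv (F0 u₀ u₁)) := hsm.differentiable (by simp)
  have hcd : Continuous (deriv (deriv (F0 u₀ u₁))) := hsm.continuous_deriv (by simp)
  have hA : (setA M u₀ u₁).Nonempty := by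
    obtain ⟨s, hs⟩ := exists_deriv_F0_ne_zero hd₀ hc₁ heven₀ heven₁ hsupp₀ hsupp₁ hne
    obtain ⟨x, hx, hx0, hx1, hx2⟩ := exists_ne_zero_and_lt_deriv hdiff hvan hs
    exact ⟨x, hx, hx0, div_pos hx2 (by linarith), two_div_mul_log_pos hx0 hx1 hx2⟩
  refine ⟨hA, ?_⟩
  obtain ⟨K₁, hK₁⟩ := (isCompact_Icc (a := -M) (b := M)).exists_bound_of_continuousOn
    hdiff.continuous.continuousOn
  obtain ⟨K₂, hK₂⟩ := (isCompact_Icc (a := -M) (b := M)).exists_bound_of_continuousOn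
    hcd.continuousOn
  obtain ⟨K, hK, hK₁K, hK₂K⟩ : ∃ K, 0 < K ∧ K₁ ≤ K ∧ K₂ ≤ K :=
    ⟨max 1 (max K₁ K₂), by simp, by simp, by simp⟩
  refine lt_of_lt_of_le (one_div_pos.2 hK) (le_csInf (hA.image _).inl ?_)
  rintro _ (⟨s, ⟨hs, hs0, hs1, hs2⟩, rfl⟩ | ⟨s, ⟨hs, -, hs1⟩, rfl⟩)
  · exact one_div_le_two_div_mul_log hs0 hs1 hs2 ((hK₁ s (Ioo_subset_Icc_self hs)).trans hK₁K)
      ((hK₂ s (Ioo_subset_Icc_self hs)).trans hK₂K)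
  · have hb := (hK₂ s (Ioo_subset_Icc_self hs)).trans hK₂K
    have hb' : deriv (deriv (F0 u₀ u₁)) s ≤ K := (le_abs_self _).trans hb
    change 1 / K ≤ 2 / deriv (deriv (F0 u₀ u₁)) s
    rw [div_le_div_iff₀ hK hs1]
    linarith
end
end

section
/- With the notation and hypotheses described in the context, there exists a constant E > 0, independent of ε, such that for all sufficiently small ε > 0: A(1/ε) ≤ Eε/2, B(1/ε) ≤ Eε, C(1/ε) ≤ E²ε², and D(1/ε) ≤ Eε. -/
open Set Filter MeasureTheory

noncomputable section

/-- `∂_t` for functions of `(t, r)` -/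
def Pt (f : ℝ → ℝ → ℝ) (t r : ℝ) : ℝ := deriv (fun s => f s r) t

/-- `∂_r` for functions of `(t, r)` -/
def Pr (f : ℝ → ℝ → ℝ) (t r : ℝ) : ℝ := deriv (fun ρ => f t ρ) r

/-- the scaling field `S = t∂_t + r∂_r` -/
def Sop (f : ℝ → ℝ → ℝ) (t r : ℝ) : ℝ := t * Pt f t r + r * Pr f t r

/-- the hyperbolic rotation `H = r∂_t + t∂_r` -/
def Hop (f : ℝ → ℝ → ℝ) (t r : ℝ) : ℝ := r * Pt f t r + t * Pr f t r

/-- the Klainerman vector fields in the radially symmetric case -/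
def Zop : Fin 4 → (ℝ → ℝ → ℝ) → ℝ → ℝ → ℝ := ![Pt, Pr, Sop, Hop]

/-- `Z^α`, a product of `|α|` Klainerman vector fields -/
def Zmulti (α : List (Fin 4)) (f : ℝ → ℝ → ℝ) : ℝ → ℝ → ℝ :=
  α.foldr (fun i g => Zop i g) f

/-- the radial Laplacian `Δ = ∂_r² + (2/r)∂_r` on ℝ³ -/
def radLap (f : ℝ → ℝ → ℝ) (t r : ℝ) : ℝ :=
  iteratedDeriv 2 (fun ρ => f t ρ) r + (2 / r) * Pr f t r

/-- `c = √(1 + u + ∂_t u)` -/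
def cfun (u : ℝ → ℝ → ℝ) (t r : ℝ) : ℝ := Real.sqrt (1 + u t r + Pt u t r)

/-- `U = r u` -/
def Ufun (u : ℝ → ℝ → ℝ) (t r : ℝ) : ℝ := r * u t r

/-- `L₁ = ∂_t + c ∂_r` -/
def L1op (u f : ℝ → ℝ → ℝ) (t r : ℝ) : ℝ := Pt f t r + cfun u t r * Pr f t r

/-- `L₂ = ∂_t - c ∂_r` -/
def L2op (u f : ℝ → ℝ → ℝ) (t r : ℝ) : ℝ := Pt f t r - cfun u t r * Pr f t r

/-- `w₁ = L₂ ∂_r U` -/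
def w1 (u : ℝ → ℝ → ℝ) : ℝ → ℝ → ℝ := L2op u (Pr (Ufun u))

/-- `w₂ = L₁ ∂_r U` -/
def w2 (u : ℝ → ℝ → ℝ) : ℝ → ℝ → ℝ := L1op u (Pr (Ufun u))

/-- `A(t) = sup_{1/ε ≤ s ≤ t} ∫_{(s,r) ∈ D} |w₁(s,r)| dr`, where `D` is the region between
the characteristics `r = rlo(t)` and `r = rhi(t)` -/
def Afun (u : ℝ → ℝ → ℝ) (rlo rhi : ℝ → ℝ) (ε t : ℝ) : ℝ :=
  sSup ((fun s => ∫ r in Set.Icc (rlo s) (rhi s), |w1 u s r|) '' Set.Icc (1 / ε) t)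

/-- `B(t) = sup_{1/ε ≤ s ≤ t, (s,r) ∈ D} s |∂_s u(s,r)|` -/
def Bfun (u : ℝ → ℝ → ℝ) (rlo rhi : ℝ → ℝ) (ε t : ℝ) : ℝ :=
  sSup ((fun p : ℝ × ℝ => p.1 * |Pt u p.1 p.2|) ''
    {p : ℝ × ℝ | p.1 ∈ Set.Icc (1 / ε) t ∧ p.2 ∈ Set.Icc (rlo p.1) (rhi p.1)})

/-- `C(t) = sup_{1/ε ≤ s ≤ t, (s,r) ∈ D} s^{3/2} |w₂(s,r)|` -/
def Cfun (u : ℝ → ℝ → ℝ) (rlo rhi : ℝ → ℝ) (ε t : ℝ) : ℝ :=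
  sSup ((fun p : ℝ × ℝ => p.1 ^ ((3 : ℝ) / 2) * |w2 u p.1 p.2|) ''
    {p : ℝ × ℝ | p.1 ∈ Set.Icc (1 / ε) t ∧ p.2 ∈ Set.Icc (rlo p.1) (rhi p.1)})

/-- `D(t) = sup_{1/ε ≤ s ≤ t, (s,r) ∈ D} s^{3/2} |L₁u(s,r)|` -/
def Dfun (u : ℝ → ℝ → ℝ) (rlo rhi : ℝ → ℝ) (ε t : ℝ) : ℝ :=
  sSup ((fun p : ℝ × ℝ => p.1 ^ ((3 : ℝ) / 2) * |L1op u u p.1 p.2|) ''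
    {p : ℝ × ℝ | p.1 ∈ Set.Icc (1 / ε) t ∧ p.2 ∈ Set.Icc (rlo p.1) (rhi p.1)})

/-- `f`, as a function of the pair `(t, r)`, is smooth on `Ω`. -/
def SmoothOnSet (Ω : Set (ℝ × ℝ)) (f : ℝ → ℝ → ℝ) : Prop :=
  ContDiffOn ℝ (⊤ : ℕ∞) (fun p : ℝ × ℝ => f p.1 p.2) Ω

section Calculus

variable {Ω : Set (ℝ × ℝ)} {f g : ℝ → ℝ → ℝ} {t r : ℝ}

lemma SmoothOnSet.contDiffAt (hΩ : IsOpen Ω) (hf : SmoothOnSet Ω f) (h : (t, r) ∈ Ω) :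
    ContDiffAt ℝ (⊤ : ℕ∞) (fun p : ℝ × ℝ => f p.1 p.2) (t, r) :=
  ContDiffOn.contDiffAt hf (hΩ.mem_nhds h)

lemma SmoothOnSet.hasFDerivAt (hΩ : IsOpen Ω) (hf : SmoothOnSet Ω f) (h : (t, r) ∈ Ω) :
    HasFDerivAt (fun p : ℝ × ℝ => f p.1 p.2)
      (fderiv ℝ (fun p : ℝ × ℝ => f p.1 p.2) (t, r)) (t, r) :=
  ((hf.contDiffAt hΩ h).differentiableAt (by simp)).hasFDerivAt

lemma SmoothOnSet.hasDerivAt_fst_fderiv (hΩ : IsOpen Ω) (hf : SmoothOnSet Ω f)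
    (h : (t, r) ∈ Ω) :
    HasDerivAt (fun s => f s r) (fderiv ℝ (fun p : ℝ × ℝ => f p.1 p.2) (t, r) (1, 0)) t :=
  (hf.hasFDerivAt hΩ h).comp_hasDerivAt_of_eq t
    ((hasDerivAt_id t).prodMk (hasDerivAt_const t r)) rfl

lemma SmoothOnSet.hasDerivAt_snd_fderiv (hΩ : IsOpen Ω) (hf : SmoothOnSet Ω f)
    (h : (t, r) ∈ Ω) :
    HasDerivAt (fun ρ => f t ρ) (fderiv ℝ (fun p : ℝ × ℝ => f p.1 p.2) (t, r) (0, 1)) r :=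
  (hf.hasFDerivAt hΩ h).comp_hasDerivAt_of_eq r
    ((hasDerivAt_const r t).prodMk (hasDerivAt_id r)) rfl

lemma SmoothOnSet.Pt_eq (hΩ : IsOpen Ω) (hf : SmoothOnSet Ω f) (h : (t, r) ∈ Ω) :
    Pt f t r = fderiv ℝ (fun p : ℝ × ℝ => f p.1 p.2) (t, r) (1, 0) :=
  (hf.hasDerivAt_fst_fderiv hΩ h).deriv

lemma SmoothOnSet.Pr_eq (hΩ : IsOpen Ω) (hf : SmoothOnSet Ω f) (h : (t, r) ∈ Ω) :
    Pr f t r = fderiv ℝ (fun p : ℝ × ℝ => f p.1 p.2) (t, r) (0, 1) :=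
  (hf.hasDerivAt_snd_fderiv hΩ h).deriv

lemma SmoothOnSet.hasDerivAt_fst (hΩ : IsOpen Ω) (hf : SmoothOnSet Ω f) (h : (t, r) ∈ Ω) :
    HasDerivAt (fun s => f s r) (Pt f t r) t :=
  (hf.hasDerivAt_fst_fderiv hΩ h).differentiableAt.hasDerivAt

lemma SmoothOnSet.hasDerivAt_snd (hΩ : IsOpen Ω) (hf : SmoothOnSet Ω f) (h : (t, r) ∈ Ω) :
    HasDerivAt (fun ρ => f t ρ) (Pr f t r) r :=
  (hf.hasDerivAt_snd_fderiv hΩ h).differentiableAt.hasDerivAt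

lemma SmoothOnSet.fderiv_apply (hΩ : IsOpen Ω) (hf : SmoothOnSet Ω f) (v : ℝ × ℝ) :
    ContDiffOn ℝ (⊤ : ℕ∞) (fun q => fderiv ℝ (fun p : ℝ × ℝ => f p.1 p.2) q v) Ω :=
  (ContDiffOn.fderiv_of_isOpen hf hΩ (by simp)).clm_apply contDiffOn_const

lemma SmoothOnSet.derivFst (hΩ : IsOpen Ω) (hf : SmoothOnSet Ω f) : SmoothOnSet Ω (Pt f) :=
  (hf.fderiv_apply hΩ (1, 0)).congr fun _ hp => hf.Pt_eq hΩ hp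

lemma SmoothOnSet.derivSnd (hΩ : IsOpen Ω) (hf : SmoothOnSet Ω f) : SmoothOnSet Ω (Pr f) :=
  (hf.fderiv_apply hΩ (0, 1)).congr fun _ hp => hf.Pr_eq hΩ hp

lemma Pt_congr_of_isOpen (hΩ : IsOpen Ω) (hfg : ∀ t r, (t, r) ∈ Ω → f t r = g t r)
    (h : (t, r) ∈ Ω) : Pt f t r = Pt g t r := by
  refine Filter.EventuallyEq.deriv_eq ?_
  have hc : ContinuousAt (fun s : ℝ => (s, r)) t := by fun_prop
  filter_upwards [hc.preimage_mem_nhds (hΩ.mem_nhds h)] with s hs using hfg s r hs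

lemma Pr_congr_of_isOpen (hΩ : IsOpen Ω) (hfg : ∀ t r, (t, r) ∈ Ω → f t r = g t r)
    (h : (t, r) ∈ Ω) : Pr f t r = Pr g t r := by
  refine Filter.EventuallyEq.deriv_eq ?_
  have hc : ContinuousAt (fun ρ : ℝ => (t, ρ)) r := by fun_prop
  filter_upwards [hc.preimage_mem_nhds (hΩ.mem_nhds h)] with ρ hs using hfg t ρ hs

lemma SmoothOnSet.Pt_Pr_comm (hΩ : IsOpen Ω) (hf : SmoothOnSet Ω f) (h : (t, r) ∈ Ω) :
    Pt (Pr f) t r = Pr (Pt f) t r := by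
  set F := fun p : ℝ × ℝ => f p.1 p.2
  have hd : DifferentiableAt ℝ (fderiv ℝ F) (t, r) :=
    ((hf.contDiffAt hΩ h).fderiv_right (m := 1) (by norm_cast)).differentiableAt (by simp)
  have key : ∀ v w : ℝ × ℝ, fderiv ℝ (fun q => fderiv ℝ F q v) (t, r) w =
      fderiv ℝ (fderiv ℝ F) (t, r) w v := by
    intro v w
    rw [fderiv_clm_apply hd (differentiableAt_const v)]
    simp
  have hsymm : IsSymmSndFDerivAt ℝ F (t, r) :=
    (hf.contDiffAt hΩ h).isSymmSndFDerivAt (by simp; norm_cast)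
  have e1 : fderiv ℝ (fun p : ℝ × ℝ => Pr f p.1 p.2) (t, r) =
      fderiv ℝ (fun q => fderiv ℝ F q (0, 1)) (t, r) := by
    refine Filter.EventuallyEq.fderiv_eq ?_
    filter_upwards [hΩ.mem_nhds h] with p hp using hf.Pr_eq hΩ hp
  have e2 : fderiv ℝ (fun p : ℝ × ℝ => Pt f p.1 p.2) (t, r) =
      fderiv ℝ (fun q => fderiv ℝ F q (1, 0)) (t, r) := by
    refine Filter.EventuallyEq.fderiv_eq ?_
    filter_upwards [hΩ.mem_nhds h] with p hp using hf.Pt_eq hΩ hp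
  rw [(hf.derivSnd hΩ).Pt_eq hΩ h, (hf.derivFst hΩ).Pr_eq hΩ h, e1, e2, key, key]
  exact hsymm.eq _ _

lemma SmoothOnSet.hasDerivWithinAt_comp_curve (hΩ : IsOpen Ω) (hf : SmoothOnSet Ω f)
    {γ : ℝ → ℝ} {γ' : ℝ} {s : Set ℝ} (hγ : HasDerivWithinAt γ γ' s t) (h : (t, γ t) ∈ Ω) :
    HasDerivWithinAt (fun τ => f τ (γ τ))
      (Pt f t (γ t) + γ' * Pr f t (γ t)) s t := by
  have := (hf.hasFDerivAt hΩ h).comp_hasDerivWithinAt_of_eq t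
    ((hasDerivWithinAt_id t s).prodMk hγ) rfl
  refine this.congr_deriv ?_
  rw [hf.Pt_eq hΩ h, hf.Pr_eq hΩ h, ← smul_eq_mul, ← map_smul, ← map_add]
  simp

end Calculus

section Equation

variable {Ω : Set (ℝ × ℝ)} {u : ℝ → ℝ → ℝ} {t r : ℝ}

/-- The square of the wave speed, `c² = 1 + u + ∂_t u`. -/
def speedSq (u : ℝ → ℝ → ℝ) (t r : ℝ) : ℝ := 1 + u t r + Pt u t r

lemma SmoothOnSet.mulRadius (hu : SmoothOnSet Ω u) : SmoothOnSet Ω (Ufun u) :=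
  contDiff_snd.contDiffOn.mul hu

lemma SmoothOnSet.smooth_speedSq (hΩ : IsOpen Ω) (hu : SmoothOnSet Ω u) : SmoothOnSet Ω (speedSq u) :=
  (contDiffOn_const.add hu).add (hu.derivFst hΩ)

lemma Pr_Ufun (hΩ : IsOpen Ω) (hu : SmoothOnSet Ω u) (h : (t, r) ∈ Ω) :
    Pr (Ufun u) t r = u t r + r * Pr u t r := by
  refine ((hasDerivAt_id r).mul (hu.hasDerivAt_snd hΩ h)).deriv.trans ?_
  simp

lemma Pr_Pr_Ufun (hΩ : IsOpen Ω) (hu : SmoothOnSet Ω u) (h : (t, r) ∈ Ω) :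
    Pr (Pr (Ufun u)) t r = 2 * Pr u t r + r * Pr (Pr u) t r := by
  rw [Pr_congr_of_isOpen (g := fun t r => u t r + r * Pr u t r) hΩ
    (fun _ _ hp => Pr_Ufun hΩ hu hp) h]
  have := (hu.hasDerivAt_snd hΩ h).add
    ((hasDerivAt_id r).mul ((hu.derivSnd hΩ).hasDerivAt_snd hΩ h))
  refine this.deriv.trans ?_
  simp only [id]
  ring

lemma Pt_Pr_Ufun (hΩ : IsOpen Ω) (hu : SmoothOnSet Ω u) (h : (t, r) ∈ Ω) :
    Pt (Pr (Ufun u)) t r = Pt u t r + r * Pt (Pr u) t r := by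
  rw [Pt_congr_of_isOpen (g := fun t r => u t r + r * Pr u t r) hΩ
    (fun _ _ hp => Pr_Ufun hΩ hu hp) h]
  exact ((hu.hasDerivAt_fst hΩ h).add
    (((hu.derivSnd hΩ).hasDerivAt_fst hΩ h).const_mul r)).deriv

lemma Pt_Pt_Ufun (hΩ : IsOpen Ω) (hu : SmoothOnSet Ω u) (h : (t, r) ∈ Ω) :
    Pt (Pt (Ufun u)) t r = r * Pt (Pt u) t r := by
  rw [Pt_congr_of_isOpen (f := Pt (Ufun u)) (g := fun t r => r * Pt u t r) hΩ
    (fun _ r hp => ((hu.hasDerivAt_fst hΩ hp).const_mul r).deriv) h]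
  exact (((hu.derivFst hΩ).hasDerivAt_fst hΩ h).const_mul r).deriv

lemma wave_equation_Ufun (hΩ : IsOpen Ω) (hu : SmoothOnSet Ω u)
    (hpde : Pt (Pt u) t r = (1 + u t r + Pt u t r) * radLap u t r)
    (hr : 0 < r) (h : (t, r) ∈ Ω) :
    Pt (Pt (Ufun u)) t r = speedSq u t r * Pr (Pr (Ufun u)) t r := by
  have hlap : radLap u t r = Pr (Pr u) t r + 2 / r * Pr u t r := by
    rw [radLap, iteratedDeriv_succ, iteratedDeriv_one]
    rfl
  rw [Pt_Pt_Ufun hΩ hu h, Pr_Pr_Ufun hΩ hu h, hpde, hlap, speedSq]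
  field_simp
  ring

lemma L1op_speedSq (hΩ : IsOpen Ω) (hu : SmoothOnSet Ω u) (h : (t, r) ∈ Ω) :
    L1op u (speedSq u) t r = L1op u u t r + L1op u (Pt u) t r := by
  have h1 : Pt (speedSq u) t r = Pt u t r + Pt (Pt u) t r :=
    (((hu.hasDerivAt_fst hΩ h).const_add 1).add ((hu.derivFst hΩ).hasDerivAt_fst hΩ h)).deriv
  have h2 : Pr (speedSq u) t r = Pr u t r + Pr (Pt u) t r :=
    (((hu.hasDerivAt_snd hΩ h).const_add 1).add ((hu.derivFst hΩ).hasDerivAt_snd hΩ h)).deriv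
  rw [L1op, L1op, L1op, h1, h2]
  ring

/-- The transport equation `L₂ w₂ = (L₁ c) ∂_r² U`, along a backward characteristic. -/
lemma hasDerivWithinAt_w2_backward (hΩ : IsOpen Ω) (hu : SmoothOnSet Ω u)
    (hwave : ∀ t r, (t, r) ∈ Ω →
      Pt (Pt (Ufun u)) t r = speedSq u t r * Pr (Pr (Ufun u)) t r)
    {γ : ℝ → ℝ} {s : Set ℝ} (hγ : HasDerivWithinAt γ (-cfun u t (γ t)) s t)
    (h : (t, γ t) ∈ Ω) (hpos : 0 < speedSq u t (γ t)) :
    HasDerivWithinAt (fun τ => w2 u τ (γ τ))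
      ((L1op u u t (γ t) + L1op u (Pt u) t (γ t)) / (2 * cfun u t (γ t)) *
        Pr (Pr (Ufun u)) t (γ t)) s t := by
  have hU := hu.mulRadius
  have hP := (hU.derivSnd hΩ).derivFst hΩ
  have hQ := (hU.derivSnd hΩ).derivSnd hΩ
  have hV := hu.smooth_speedSq hΩ
  have hc : cfun u t (γ t) = Real.sqrt (speedSq u t (γ t)) := rfl
  have hc0 : 0 < cfun u t (γ t) := by rw [hc]; exact Real.sqrt_pos.2 hpos
  have hcc : cfun u t (γ t) * cfun u t (γ t) = speedSq u t (γ t) := by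
    rw [hc]; exact Real.mul_self_sqrt hpos.le
  have hPrP : Pr (Pt (Pr (Ufun u))) t (γ t) = Pt (Pr (Pr (Ufun u))) t (γ t) :=
    ((hU.derivSnd hΩ).Pt_Pr_comm hΩ h).symm
  have hPtP : Pt (Pt (Pr (Ufun u))) t (γ t) =
      Pr (speedSq u) t (γ t) * Pr (Pr (Ufun u)) t (γ t) +
        speedSq u t (γ t) * Pr (Pr (Pr (Ufun u))) t (γ t) := by
    rw [Pt_congr_of_isOpen hΩ (fun _ _ hp => hU.Pt_Pr_comm hΩ hp) h,
      (hU.derivFst hΩ).Pt_Pr_comm hΩ h, Pr_congr_of_isOpen hΩ hwave h]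
    exact ((hV.hasDerivAt_snd hΩ h).mul (hQ.hasDerivAt_snd hΩ h)).deriv
  have hmain := (hP.hasDerivWithinAt_comp_curve hΩ hγ h).add
    (((hV.hasDerivWithinAt_comp_curve hΩ hγ h).sqrt hpos.ne').mul
      (hQ.hasDerivWithinAt_comp_curve hΩ hγ h))
  refine hmain.congr_deriv ?_
  rw [← L1op_speedSq hΩ hu h, L1op, hPrP, hPtP, ← hc, ← hcc]
  field_simp
  ring

end Equation

section Bounds

/-- The decay estimates that are used at a single point `(t, r)` near the light cone, with the
weight in `t - r` absorbed into the constant `C`. -/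
structure ConeBounds (u : ℝ → ℝ → ℝ) (C ε t r : ℝ) : Prop where
  self : |u t r| ≤ C * ε / (1 + t)
  pt : |Pt u t r| ≤ C * ε / (1 + t)
  pr : |Pr u t r| ≤ C * ε / (1 + t)
  pr_pt : |Pr (Pt u) t r| ≤ C * ε / (1 + t)
  pt_pr : |Pt (Pr u) t r| ≤ C * ε / (1 + t)
  pr_pr : |Pr (Pr u) t r| ≤ C * ε / (1 + t)
  scaling : |Sop u t r| ≤ C * ε / (1 + t)
  rotation : |Hop u t r| ≤ C * ε / (1 + t)
  scaling_pt : |Sop (Pt u) t r| ≤ C * ε / (1 + t)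
  rotation_pt : |Hop (Pt u) t r| ≤ C * ε / (1 + t)

lemma coneBounds_of_estimates {u : ℝ → ℝ → ℝ} {Cb ε t r R : ℝ} (hCb : 0 < Cb) (hε : 0 < ε)
    (ht : 0 ≤ t) (hR : |t - r| ≤ R)
    (h1 : ∀ α : List (Fin 4), α.length ≤ 2 →
      |Zmulti α u t r| ≤ Cb * ε * (1 + t)⁻¹ * Real.sqrt (1 + |t - r|))
    (h2 : ∀ α : List (Fin 4), α.length ≤ 2 →
      |Zmulti α (Pt u) t r| ≤ Cb * ε * (1 + t)⁻¹ * (Real.sqrt (1 + |t - r|))⁻¹ ∧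
      |Zmulti α (Pr u) t r| ≤ Cb * ε * (1 + t)⁻¹ * (Real.sqrt (1 + |t - r|))⁻¹) :
    ConeBounds u (Cb * Real.sqrt (1 + R)) ε t r := by
  have hs : Real.sqrt (1 + |t - r|) ≤ Real.sqrt (1 + R) := Real.sqrt_le_sqrt (by linarith)
  have hs1 : 1 ≤ Real.sqrt (1 + |t - r|) :=
    Real.one_le_sqrt.2 (by linarith [abs_nonneg (t - r)])
  have hs2 : (Real.sqrt (1 + |t - r|))⁻¹ ≤ Real.sqrt (1 + R) :=
    (inv_le_one_of_one_le₀ hs1).trans (hs1.trans hs)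
  have e : Cb * Real.sqrt (1 + R) * ε / (1 + t) = Cb * ε * (1 + t)⁻¹ * Real.sqrt (1 + R) := by
    ring
  have b1 : ∀ α : List (Fin 4), α.length ≤ 2 →
      |Zmulti α u t r| ≤ Cb * Real.sqrt (1 + R) * ε / (1 + t) := fun α hα => by
    rw [e]; exact (h1 α hα).trans (by gcongr)
  have b2 : ∀ α : List (Fin 4), α.length ≤ 2 →
      |Zmulti α (Pt u) t r| ≤ Cb * Real.sqrt (1 + R) * ε / (1 + t) := fun α hα => by
    rw [e]; exact (h2 α hα).1.trans (by gcongr)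
  have b3 : ∀ α : List (Fin 4), α.length ≤ 2 →
      |Zmulti α (Pr u) t r| ≤ Cb * Real.sqrt (1 + R) * ε / (1 + t) := fun α hα => by
    rw [e]; exact (h2 α hα).2.trans (by gcongr)
  exact ⟨b1 [] (by simp), b2 [] (by simp), b3 [] (by simp), b2 [1] (by simp), b3 [0] (by simp),
    b3 [1] (by simp), b1 [2] (by simp), b1 [3] (by simp), b2 [2] (by simp), b2 [3] (by simp)⟩

lemma abs_sqrt_sub_one_le (x : ℝ) : |Real.sqrt x - 1| ≤ |x - 1| := by
  rcases le_total x 0 with hx | hx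
  · rw [Real.sqrt_eq_zero_of_nonpos hx, abs_of_nonpos (by linarith), abs_of_nonpos (by linarith)]
    linarith
  · have hs := Real.sqrt_nonneg x
    have e : x - 1 = (Real.sqrt x - 1) * (Real.sqrt x + 1) := by
      nlinarith [Real.mul_self_sqrt hx]
    rw [e, abs_mul, abs_of_pos (by linarith : 0 < Real.sqrt x + 1)]
    nlinarith [abs_nonneg (Real.sqrt x - 1)]

lemma abs_cfun_sub_one_le {u : ℝ → ℝ → ℝ} {t r m : ℝ} (h0 : |u t r| ≤ m) (h1 : |Pt u t r| ≤ m) :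
    |cfun u t r - 1| ≤ 2 * m := by
  refine (abs_sqrt_sub_one_le _).trans ?_
  rw [abs_le] at *
  constructor <;> linarith

variable {u f : ℝ → ℝ → ℝ} {C ε t r R : ℝ}

lemma ConeBounds.abs_cfun_sub_one_le (h : ConeBounds u C ε t r) :
    |cfun u t r - 1| ≤ 2 * (C * ε / (1 + t)) :=
  _root_.abs_cfun_sub_one_le h.self h.pt

lemma ConeBounds.weight_le (h : ConeBounds u C ε t r) (ht : 0 ≤ t) :
    C * ε / (1 + t) ≤ C * ε := by
  have h0 : 0 ≤ C * ε / (1 + t) := (abs_nonneg _).trans h.self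
  have : C * ε / (1 + t) * (1 + t) = C * ε := by field_simp
  nlinarith

lemma ConeBounds.cfun_mem (h : ConeBounds u C ε t r) (ht : 0 ≤ t) (hs : C * ε ≤ 1 / 4) :
    cfun u t r ∈ Icc (1 / 2) (3 / 2) := by
  have := abs_le.1 h.abs_cfun_sub_one_le
  have := h.weight_le ht
  constructor <;> linarith

lemma ConeBounds.speedSq_pos (h : ConeBounds u C ε t r) (ht : 0 ≤ t) (hs : C * ε ≤ 1 / 4) :
    0 < speedSq u t r := by
  have := (h.cfun_mem ht hs).1
  exact Real.sqrt_pos.1 (by change 0 < cfun u t r; linarith)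

lemma abs_L1op_le (h : ConeBounds u C ε t r) (hC : 0 < C) (hε : 0 < ε) (hε1 : ε < 1) (ht : 0 ≤ t)
    (htr : 1 + t ≤ t + r)
    (hf : |Pr f t r| ≤ C * ε / (1 + t)) (hS : |Sop f t r| ≤ C * ε / (1 + t))
    (hH : |Hop f t r| ≤ C * ε / (1 + t)) :
    |L1op u f t r| ≤ (2 * C + 2 * C ^ 2) * ε / (1 + t) ^ 2 := by
  have hd : |Pt f t r + Pr f t r| ≤ 2 * (C * ε / (1 + t)) / (1 + t) := by
    rw [le_div_iff₀ (by linarith)]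
    calc |Pt f t r + Pr f t r| * (1 + t) ≤ |Pt f t r + Pr f t r| * (t + r) := by gcongr
      _ = |Sop f t r + Hop f t r| := by
        rw [show Sop f t r + Hop f t r = (Pt f t r + Pr f t r) * (t + r) by rw [Sop, Hop]; ring,
          abs_mul, abs_of_pos (by linarith : 0 < t + r)]
      _ ≤ |Sop f t r| + |Hop f t r| := abs_add_le _ _
      _ ≤ _ := by linarith
  have e : L1op u f t r = (Pt f t r + Pr f t r) + (cfun u t r - 1) * Pr f t r := by
    rw [L1op]; ring
  have hp : |(cfun u t r - 1) * Pr f t r| ≤ 2 * (C * ε / (1 + t)) * (C * ε / (1 + t)) := by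
    rw [abs_mul]
    exact mul_le_mul h.abs_cfun_sub_one_le hf (abs_nonneg _) (by positivity)
  calc |L1op u f t r| ≤ |Pt f t r + Pr f t r| + |(cfun u t r - 1) * Pr f t r| := by
        rw [e]; exact abs_add_le _ _
    _ ≤ 2 * (C * ε / (1 + t)) / (1 + t) + 2 * (C * ε / (1 + t)) * (C * ε / (1 + t)) := by
        linarith
    _ = (2 * C * ε + 2 * C ^ 2 * ε ^ 2) / (1 + t) ^ 2 := by field_simp
    _ ≤ _ := by
        gcongr
        nlinarith [mul_pos (pow_pos hC 2) hε]

lemma ConeBounds.radius_mul_le (h : ConeBounds u C ε t r) (hC : 0 < C) (hε : 0 < ε) (ht : 0 ≤ t)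
    (hR : |t - r| ≤ R) :
    2 * (C * ε / (1 + t)) + r * (C * ε / (1 + t)) ≤ (R + 2) * C * ε := by
  have hrR := (abs_le.1 hR).1
  have hR0 : 0 ≤ R := (abs_nonneg _).trans hR
  have e : C * ε / (1 + t) * (1 + t) = C * ε := by field_simp
  have h0 : 0 ≤ C * ε / (1 + t) := by positivity
  have h1 := h.weight_le ht
  nlinarith [mul_le_mul_of_nonneg_right (by linarith : r ≤ R + t) h0,
    mul_le_mul_of_nonneg_left h1 hR0]

variable {Ω : Set (ℝ × ℝ)}

lemma ConeBounds.abs_Pr_Pr_Ufun_le (h : ConeBounds u C ε t r) (hΩ : IsOpen Ω)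
    (hu : SmoothOnSet Ω u) (hp : (t, r) ∈ Ω) (hC : 0 < C) (hε : 0 < ε) (ht : 0 ≤ t)
    (hr : 0 ≤ r) (hR : |t - r| ≤ R) :
    |Pr (Pr (Ufun u)) t r| ≤ (R + 2) * C * ε := by
  refine le_trans ?_ (h.radius_mul_le hC hε ht hR)
  rw [Pr_Pr_Ufun hΩ hu hp]
  refine (abs_add_le _ _).trans ?_
  rw [abs_mul, abs_mul, abs_of_nonneg hr, abs_of_pos (by norm_num : (0 : ℝ) < 2)]
  gcongr
  exacts [h.pr, h.pr_pr]

lemma ConeBounds.abs_Pt_Pr_Ufun_le (h : ConeBounds u C ε t r) (hΩ : IsOpen Ω)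
    (hu : SmoothOnSet Ω u) (hp : (t, r) ∈ Ω) (hC : 0 < C) (hε : 0 < ε) (ht : 0 ≤ t)
    (hr : 0 ≤ r) (hR : |t - r| ≤ R) :
    |Pt (Pr (Ufun u)) t r| ≤ (R + 2) * C * ε := by
  refine le_trans ?_ (h.radius_mul_le hC hε ht hR)
  rw [Pt_Pr_Ufun hΩ hu hp]
  refine (abs_add_le _ _).trans ?_
  rw [abs_mul, abs_of_nonneg hr]
  have h0 : 0 ≤ C * ε / (1 + t) := by positivity
  have := mul_le_mul_of_nonneg_left h.pt_pr hr
  linarith [h.pt]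

lemma ConeBounds.abs_w1_le (h : ConeBounds u C ε t r) (hΩ : IsOpen Ω)
    (hu : SmoothOnSet Ω u) (hp : (t, r) ∈ Ω) (hC : 0 < C) (hε : 0 < ε) (ht : 0 ≤ t)
    (hr : 0 ≤ r) (hR : |t - r| ≤ R) (hs : C * ε ≤ 1 / 4) :
    |w1 u t r| ≤ 3 * ((R + 2) * C * ε) := by
  have h1 := h.abs_Pt_Pr_Ufun_le hΩ hu hp hC hε ht hr hR
  have h2 := h.abs_Pr_Pr_Ufun_le hΩ hu hp hC hε ht hr hR
  have hc := h.cfun_mem ht hs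
  rw [w1, L2op, sub_eq_add_neg]
  refine (abs_add_le _ _).trans ?_
  rw [abs_neg, abs_mul, abs_of_nonneg (by linarith [hc.1] : 0 ≤ cfun u t r)]
  have := mul_le_mul hc.2 h2 (abs_nonneg _) (by norm_num)
  linarith [(abs_nonneg _).trans h2]

/-- The source term in the transport equation for `w₂` is `O(ε² (1 + t)⁻²)`. -/
lemma ConeBounds.abs_source_le (h : ConeBounds u C ε t r) (hΩ : IsOpen Ω)
    (hu : SmoothOnSet Ω u) (hp : (t, r) ∈ Ω) (hC : 0 < C) (hε : 0 < ε) (hε1 : ε < 1) (ht : 0 ≤ t)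
    (htr : 1 ≤ r) (hR : |t - r| ≤ R) (hs : C * ε ≤ 1 / 4) :
    |(L1op u u t r + L1op u (Pt u) t r) / (2 * cfun u t r) * Pr (Pr (Ufun u)) t r| ≤
      2 * (2 * C + 2 * C ^ 2) * ((R + 2) * C) * ε ^ 2 / (1 + t) ^ 2 := by
  have h1 := abs_L1op_le h hC hε hε1 ht (by linarith) h.pr h.scaling h.rotation
  have h2 := abs_L1op_le h hC hε hε1 ht (by linarith) h.pr_pt h.scaling_pt h.rotation_pt
  have h3 := h.abs_Pr_Pr_Ufun_le hΩ hu hp hC hε ht (by linarith) hR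
  have hc := (h.cfun_mem ht hs).1
  have h4 : |(L1op u u t r + L1op u (Pt u) t r) / (2 * cfun u t r)| ≤
      2 * ((2 * C + 2 * C ^ 2) * ε / (1 + t) ^ 2) := by
    rw [abs_div, abs_of_pos (by linarith : 0 < 2 * cfun u t r)]
    refine (div_le_self (abs_nonneg _) (by linarith)).trans ?_
    linarith [abs_add_le (L1op u u t r) (L1op u (Pt u) t r)]
  rw [abs_mul]
  refine (mul_le_mul h4 h3 (abs_nonneg _) (by positivity)).trans (le_of_eq ?_)
  ring

end Bounds

section Characteristics

/-- Picard–Lindelöf, recording in addition that the solution stays in the ball. -/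
lemma exists_solution_mem_closedBall {f : ℝ → ℝ → ℝ} {tmin tmax : ℝ} {t₀ : Icc tmin tmax}
    {x₀ : ℝ} {a L K : NNReal} (hf : IsPicardLindelof f t₀ x₀ a 0 L K) :
    ∃ α : ℝ → ℝ, α t₀ = x₀ ∧ ∀ t ∈ Icc tmin tmax, α t ∈ Metric.closedBall x₀ a ∧
      HasDerivWithinAt α (f t (α t)) (Icc tmin tmax) t := by
  have hx : x₀ ∈ Metric.closedBall x₀ ((0 : NNReal) : ℝ) := by simp
  obtain ⟨α, hα⟩ := ODE.FunSpace.exists_isFixedPt_next hf hx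
  refine ⟨α.compProj, ?_, fun t ht => ⟨α.compProj_mem_closedBall hf.mul_max_le, ?_⟩⟩
  · rw [ODE.FunSpace.compProj_val, ← hα, ODE.FunSpace.next_apply₀]
  apply ODE.hasDerivWithinAt_picard_Icc t₀.2 hf.continuousOn_uncurry
    α.continuous_compProj.continuousOn (fun _ _ => α.compProj_mem_closedBall hf.mul_max_le)
    x₀ ht |>.congr_of_mem _ ht
  intro t' ht'
  nth_rw 1 [← hα]
  rw [ODE.FunSpace.compProj_of_mem ht', ODE.FunSpace.next_apply]

variable {u : ℝ → ℝ → ℝ} {C ε : ℝ} {Ω : Set (ℝ × ℝ)}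

/-- Backward characteristics `dr/dt = -c` through `(t₀, r₀)` exist on `[t₀ - T, t₀]`. -/
lemma exists_backward_characteristic (hΩ : IsOpen Ω) (hu : SmoothOnSet Ω u) {t₀ r₀ T : ℝ}
    (hT : 0 < T) (hT₀ : T ≤ t₀) (hs : C * ε ≤ 1 / 4)
    (hmem : ∀ t ∈ Icc (t₀ - T) t₀, ∀ r ∈ Metric.closedBall r₀ (2 * T),
      (t, r) ∈ Ω ∧ ConeBounds u C ε t r) :
    ∃ γ : ℝ → ℝ, γ t₀ = r₀ ∧ ∀ t ∈ Icc (t₀ - T) t₀, γ t ∈ Metric.closedBall r₀ (2 * T) ∧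
      HasDerivWithinAt γ (-cfun u t (γ t)) (Icc (t₀ - T) t₀) t := by
  have hV := hu.smooth_speedSq hΩ
  have hpl : IsPicardLindelof (fun t r => -cfun u t r)
      (⟨t₀, by linarith, le_rfl⟩ : Icc (t₀ - T) t₀) r₀ ⟨2 * T, by positivity⟩ 0 2 1 := by
    refine ⟨fun t ht => ?_, fun r hr => ?_, fun t ht r hr => ?_, ?_⟩
    · refine (convex_closedBall r₀ _).lipschitzOnWith_of_nnnorm_hasDerivWithin_le
        (f' := fun r => -(Pr (speedSq u) t r / (2 * cfun u t r))) (fun r hr => ?_) fun r hr => ?_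
      · obtain ⟨hp, hb⟩ := hmem t ht r hr
        exact (((hV.hasDerivAt_snd hΩ hp).sqrt
          (hb.speedSq_pos (by linarith [ht.1]) hs).ne').neg).hasDerivWithinAt
      · obtain ⟨hp, hb⟩ := hmem t ht r hr
        have ht0 : 0 ≤ t := by linarith [ht.1]
        have hc := (hb.cfun_mem ht0 hs).1
        have hd : Pr (speedSq u) t r = Pr u t r + Pr (Pt u) t r :=
          (((hu.hasDerivAt_snd hΩ hp).const_add 1).add
            ((hu.derivFst hΩ).hasDerivAt_snd hΩ hp)).deriv
        rw [← NNReal.coe_le_coe, coe_nnnorm, norm_neg, Real.norm_eq_abs, abs_div, hd,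
          abs_of_pos (by linarith : 0 < 2 * cfun u t r)]
        refine (div_le_self (abs_nonneg _) (by linarith)).trans ((abs_add_le _ _).trans ?_)
        have := hb.weight_le ht0
        simp only [NNReal.coe_one]
        linarith [hb.pr, hb.pr_pt]
    · intro t ht
      obtain ⟨hp, hb⟩ := hmem t ht r hr
      exact ((hV.hasDerivAt_fst hΩ hp).continuousAt.sqrt.neg).continuousWithinAt
    · obtain ⟨hp, hb⟩ := hmem t ht r hr
      have hc := hb.cfun_mem (by linarith [ht.1]) hs
      rw [norm_neg, Real.norm_eq_abs, abs_of_nonneg (by linarith [hc.1])]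
      simp only [NNReal.coe_ofNat]
      linarith [hc.2]
    · simp only [NNReal.coe_ofNat, NNReal.coe_zero, sub_zero, sub_self, sub_sub_cancel,
        max_eq_right hT.le]
      exact le_rfl
  exact exists_solution_mem_closedBall hpl

lemma w2_eq_zero_of_isOpen (hΩ : IsOpen Ω) (hz : ∀ t r, (t, r) ∈ Ω → u t r = 0) {t r : ℝ}
    (h : (t, r) ∈ Ω) : w2 u t r = 0 := by
  have h0 : ∀ t r, (t, r) ∈ Ω → Pr (Ufun u) t r = 0 := fun t r hp => by
    rw [Pr_congr_of_isOpen (g := fun _ _ => 0) hΩ (fun t r hq => by simp [Ufun, hz t r hq]) hp]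
    simp [Pr]
  rw [w2, L1op, Pt_congr_of_isOpen (g := fun _ _ => 0) hΩ h0 h,
    Pr_congr_of_isOpen (g := fun _ _ => 0) hΩ h0 h]
  simp [Pt, Pr]

/-- `w₂` is obtained near the light cone by integrating its transport equation along a backward
characteristic from outside the support of `u`. -/
lemma abs_w2_le (hΩ : IsOpen Ω) (hu : SmoothOnSet Ω u)
    (hwave : ∀ t r, (t, r) ∈ Ω →
      Pt (Pt (Ufun u)) t r = speedSq u t r * Pr (Pr (Ufun u)) t r)
    {t₀ r₀ T R M Q K : ℝ} (hM : 0 < M) (hC : 0 < C) (hε : 0 < ε) (hε1 : ε < 1) (hs : C * ε ≤ 1 / 4)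
    (hQ : |t₀ - r₀| ≤ Q) (hT : T = Q + M + 1) (hR : R = Q + 3 * T) (hK : R + 1 + T ≤ t₀)
    (hKdef : K = 2 * (2 * C + 2 * C ^ 2) * ((R + 2) * C))
    (hzero : ∃ Ω' : Set (ℝ × ℝ), IsOpen Ω' ∧ (∀ t r, (t, r) ∈ Ω' → u t r = 0) ∧
      ∀ r, t₀ - T + M < r → (t₀ - T, r) ∈ Ω')
    (hmem : ∀ t ∈ Icc (t₀ - T) t₀, ∀ r, |t - r| ≤ R → (t, r) ∈ Ω ∧ ConeBounds u C ε t r) :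
    |w2 u t₀ r₀| ≤ 4 * K * T * ε ^ 2 / t₀ ^ 2 := by
  have hQ0 : 0 ≤ Q := (abs_nonneg _).trans hQ
  have hT0 : 0 < T := by linarith
  have hball : ∀ t ∈ Icc (t₀ - T) t₀, ∀ r ∈ Metric.closedBall r₀ (2 * T), |t - r| ≤ R := by
    intro t ht r hr
    rw [Metric.mem_closedBall, Real.dist_eq, abs_le] at hr
    rw [abs_le] at hQ ⊢
    constructor <;> linarith [ht.1, ht.2, hr.1, hr.2, hQ.1, hQ.2]
  obtain ⟨γ, hγ₀, hγ⟩ := exists_backward_characteristic hΩ hu hT0 (by linarith) hs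
    fun t ht r hr => hmem t ht r (hball t ht r hr)
  have hcone : ∀ t ∈ Icc (t₀ - T) t₀, |t - γ t| ≤ R := fun t ht => hball t ht _ (hγ t ht).1
  have hleft : t₀ - T ∈ Icc (t₀ - T) t₀ := ⟨le_rfl, by linarith⟩
  have hright : t₀ ∈ Icc (t₀ - T) t₀ := ⟨by linarith, le_rfl⟩
  have hexit : t₀ - T + M < γ (t₀ - T) := by
    have := norm_image_sub_le_of_norm_deriv_le_segment' (f := fun t => γ t + t) (C := 1 / 2)
      (fun t ht => (hγ t ht).2.add (hasDerivWithinAt_id t _)) (fun t ht => by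
        have ht' := Ico_subset_Icc_self ht
        have hc := (hmem t ht' _ (hcone t ht')).2.cfun_mem (by linarith [ht.1]) hs
        rw [Real.norm_eq_abs, abs_le]
        constructor <;> linarith [hc.1, hc.2]) t₀ hright
    simp only [Real.norm_eq_abs, hγ₀] at this
    rw [abs_le] at this hQ
    linarith [this.2, hQ.2]
  have hw0 : w2 u (t₀ - T) (γ (t₀ - T)) = 0 := by
    obtain ⟨Ω', hΩ', hz, hin⟩ := hzero
    exact w2_eq_zero_of_isOpen hΩ' hz (hin _ hexit)
  have hmain := norm_image_sub_le_of_norm_deriv_le_segment' (f := fun t => w2 u t (γ t))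
    (C := 4 * K * ε ^ 2 / t₀ ^ 2)
    (fun t ht => hasDerivWithinAt_w2_backward hΩ hu hwave (hγ t ht).2
      (hmem t ht _ (hcone t ht)).1
      ((hmem t ht _ (hcone t ht)).2.speedSq_pos (by linarith [ht.1]) hs))
    (fun t ht => by
      have ht' := Ico_subset_Icc_self ht
      have hd := hcone t ht'
      obtain ⟨hp, hb⟩ := hmem t ht' _ hd
      refine (hb.abs_source_le hΩ hu hp hC hε hε1 (by linarith [ht.1])
        (by linarith [ht.1, (abs_le.1 hd).2]) hd hs).trans ?_
      have hK0 : 0 ≤ K * ε ^ 2 := by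
        have : 0 ≤ R := by linarith
        rw [hKdef]; positivity
      rw [← hKdef, show 4 * K * ε ^ 2 / t₀ ^ 2 = K * ε ^ 2 / (t₀ / 2) ^ 2 by
        field_simp; ring]
      have : 0 < t₀ / 2 := by linarith
      gcongr
      linarith [ht.1]) t₀ hright
  rw [hw0, hγ₀, sub_zero, Real.norm_eq_abs] at hmain
  refine hmain.trans (le_of_eq ?_)
  ring

/-- A curve with `|dr/dt - 1| ≤ K (1 + |t - r|)` stays near the light cone. -/
lemma abs_sub_le_of_deriv_near_one {γ c : ℝ → ℝ} {K t q : ℝ} (hK : 0 < K) (ht : 0 ≤ t)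
    (hγ : ∀ s ∈ Icc 0 t, HasDerivAt γ (c s) s)
    (hc : ∀ s ∈ Icc 0 t, |c s - 1| ≤ K * (1 + |s - γ s|)) (hq : |γ 0| ≤ q) :
    |t - γ t| ≤ (q + 1) * Real.exp (K * t) := by
  have h := norm_le_gronwallBound_of_norm_deriv_right_le (f := fun s => s - γ s)
    (f' := fun s => 1 - c s) (δ := q) (K := K) (ε := K) (a := 0) (b := t)
    (fun s hs => ((hasDerivAt_id s).sub (hγ s hs)).continuousAt.continuousWithinAt)
    (fun s hs => ((hasDerivAt_id s).sub (hγ s (Ico_subset_Icc_self hs))).hasDerivWithinAt)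
    (by simpa using hq)
    (fun s hs => by
      rw [Real.norm_eq_abs, Real.norm_eq_abs, abs_sub_comm]
      linarith [hc s (Ico_subset_Icc_self hs)])
    t ⟨ht, le_rfl⟩
  rw [gronwallBound_of_K_ne_0 hK.ne', div_self hK.ne', Real.norm_eq_abs] at h
  simp only [sub_zero] at h
  linarith

end Characteristics

/-- The weight `t^{3/2}` is dominated by `t²` for large times. -/
lemma rpow_three_halves_mul_le {t x K : ℝ} (ht : 1 ≤ t) (hx0 : 0 ≤ x) (hx : x ≤ K / t ^ 2) :
    t ^ ((3 : ℝ) / 2) * x ≤ K := by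
  have h0 : 0 < t := by linarith
  have h1 : t ^ ((3 : ℝ) / 2) ≤ t ^ 2 := by
    rw [← Real.rpow_natCast]
    exact Real.rpow_le_rpow_of_exponent_le ht (by norm_num)
  calc t ^ ((3 : ℝ) / 2) * x ≤ t ^ 2 * x := by gcongr
    _ ≤ t ^ 2 * (K / t ^ 2) := by gcongr
    _ = K := by field_simp

theorem initial_bounds_at_one_over_eps (M : ℝ) (hM : 0 < M) (u₀ u₁ : ℝ → ℝ)
    (hu₀ : ContDiff ℝ (⊤ : ℕ∞) u₀) (hu₁ : ContDiff ℝ (⊤ : ℕ∞) u₁)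
    (heven₀ : ∀ s, u₀ (-s) = u₀ s) (heven₁ : ∀ s, u₁ (-s) = u₁ s)
    (hsupp₀ : ∀ s, M < |s| → u₀ s = 0) (hsupp₁ : ∀ s, M < |s| → u₁ s = 0)
    (hne : u₀ ≠ 0 ∨ u₁ ≠ 0)
    -- ρ₀ is a point at which τ₀ is attained
    (ρ₀ : ℝ) (hρ₀ : ρ₀ ∈ Set.Ioo (-M) M)
    (hatt : tauOf u₀ u₁ ρ₀ = tau0 M u₀ u₁ ∨
      2 / deriv (deriv (F0 u₀ u₁)) ρ₀ = tau0 M u₀ u₁)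
    (b : ℝ) (hb : 0 < b) (hbτ : b < tau0 M u₀ u₁) (Cb : ℝ) (hCb : 0 < Cb) :
    ∃ E > 0, ∃ ε₀ > 0, ∀ ε : ℝ, 0 < ε → ε < ε₀ → ε < 1 →
      1 / ε < Real.exp (b / ε) - 1 →
      ∀ u : ℝ → ℝ → ℝ, ∀ rlo rhi : ℝ → ℝ,
        -- u is a C^∞ radially symmetric solution up to time T_b = e^{b/ε} - 1
        ContDiffOn ℝ (⊤ : ℕ∞) (fun p : ℝ × ℝ => u p.1 p.2)
          (Set.Icc 0 (Real.exp (b / ε) - 1) ×ˢ (Set.univ : Set ℝ)) →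
        (∀ t ∈ Set.Icc (0 : ℝ) (Real.exp (b / ε) - 1), ∀ r : ℝ, 0 < r →
          Pt (Pt u) t r = (1 + u t r + Pt u t r) * radLap u t r) →
        (∀ r : ℝ, u 0 r = ε * u₀ r) → (∀ r : ℝ, Pt u 0 r = ε * u₁ r) →
        -- finite propagation speed: supp u(t,·) ⊆ {r ≤ t + M}
        (∀ t ∈ Set.Icc (0 : ℝ) (Real.exp (b / ε) - 1), ∀ r : ℝ, t + M < r → u t r = 0) →
        -- Section 2 estimates
        (∀ α : List (Fin 4), α.length ≤ 2 →
          ∀ t ∈ Set.Icc (0 : ℝ) (Real.exp (b / ε) - 1), ∀ r : ℝ,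
            |Zmulti α u t r| ≤ Cb * ε * (1 + t)⁻¹ * Real.sqrt (1 + |t - r|)) →
        (∀ α : List (Fin 4), α.length ≤ 2 →
          ∀ t ∈ Set.Icc (0 : ℝ) (Real.exp (b / ε) - 1), ∀ r : ℝ,
            |Zmulti α (Pt u) t r| ≤ Cb * ε * (1 + t)⁻¹ * (Real.sqrt (1 + |t - r|))⁻¹ ∧
            |Zmulti α (Pr u) t r| ≤ Cb * ε * (1 + t)⁻¹ * (Real.sqrt (1 + |t - r|))⁻¹) →
        -- the forward characteristics Γ⁺_{ρ₀-1} and Γ⁺_M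
        rlo 0 = ρ₀ - 1 → rhi 0 = M →
        (∀ t ∈ Set.Icc (0 : ℝ) (Real.exp (b / ε) - 1),
          HasDerivAt rlo (cfun u t (rlo t)) t ∧ HasDerivAt rhi (cfun u t (rhi t)) t) →
        Afun u rlo rhi ε (1 / ε) ≤ E * ε / 2 ∧
        Bfun u rlo rhi ε (1 / ε) ≤ E * ε ∧
        Cfun u rlo rhi ε (1 / ε) ≤ E ^ 2 * ε ^ 2 ∧
        Dfun u rlo rhi ε (1 / ε) ≤ E * ε := by
  obtain ⟨Q, hQ⟩ : ∃ Q, Q = (|ρ₀| + M + 1 + 1) * Real.exp (2 * Cb) := ⟨_, rfl⟩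
  have hQ0 : 0 < Q := by rw [hQ]; positivity
  obtain ⟨T, hT⟩ : ∃ T, T = Q + M + 1 := ⟨_, rfl⟩
  obtain ⟨R, hR⟩ : ∃ R, R = Q + 3 * T := ⟨_, rfl⟩
  have hT0 : 0 < T := by linarith
  have hR0 : 0 < R := by linarith
  obtain ⟨C, hC⟩ : ∃ C, C = Cb * Real.sqrt (1 + R) := ⟨_, rfl⟩
  have hC0 : 0 < C := by rw [hC]; positivity
  obtain ⟨K, hK⟩ : ∃ K, K = 2 * (2 * C + 2 * C ^ 2) * ((R + 2) * C) := ⟨_, rfl⟩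
  have hK0 : 0 < K := by rw [hK]; positivity
  obtain ⟨E, hE⟩ : ∃ E, E = 1 + (2 * C + 2 * C ^ 2) + 12 * ((R + 2) * C) * Q + 4 * K * T :=
    ⟨_, rfl⟩
  have hn1 : 0 < 2 * C + 2 * C ^ 2 := by positivity
  have hn2 : 0 < 12 * ((R + 2) * C) * Q := by positivity
  have hn3 : 0 < 4 * K * T := by positivity
  have hE1 : 1 ≤ E := by linarith
  have hEA : 12 * ((R + 2) * C) * Q ≤ E := by linarith
  have hEB : C ≤ E := by linarith [sq_nonneg C]
  have hEC : 4 * K * T ≤ E ^ 2 := by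
    have : E ≤ E ^ 2 := le_self_pow₀ hE1 (by norm_num)
    linarith
  have hED : 2 * C + 2 * C ^ 2 ≤ E := by linarith
  have hE0 : 0 < E := by linarith
  clear hE hn1 hn2 hn3 hE1
  refine ⟨E, hE0, min (1 / (R + 1 + T)) (1 / (4 * C)), by positivity, ?_⟩
  intro ε hε hε₀ hε1 hTb u rlo rhi hsm hpde _ _ hsupp hest hest' hlo hhi hchar
  generalize Real.exp (b / ε) - 1 = Tb at *
  obtain ⟨t₀, ht₀⟩ : ∃ t₀, t₀ = 1 / ε := ⟨_, rfl⟩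
  have hεt : ε = 1 / t₀ := by rw [ht₀, one_div_one_div]
  have hlarge : R + 1 + T ≤ t₀ := by
    rw [ht₀, le_one_div (by linarith) hε]
    exact (hε₀.trans_le (min_le_left _ _)).le
  have hsmall : C * ε ≤ 1 / 4 := by
    have := (hε₀.trans_le (min_le_right _ _)).le
    rw [le_div_iff₀ (by positivity)] at this
    linarith
  have ht0 : 0 < t₀ := by linarith
  have ht1 : 1 ≤ t₀ := by linarith
  rw [← ht₀] at hTb ⊢
  have hΩ : IsOpen (Ioo 0 Tb ×ˢ Ioi (0 : ℝ)) := isOpen_Ioo.prod isOpen_Ioi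
  have hu : SmoothOnSet (Ioo 0 Tb ×ˢ Ioi (0 : ℝ)) u :=
    hsm.mono (prod_mono Ioo_subset_Icc_self (subset_univ _))
  have hwave : ∀ t r, (t, r) ∈ Ioo 0 Tb ×ˢ Ioi (0 : ℝ) →
      Pt (Pt (Ufun u)) t r = speedSq u t r * Pr (Pr (Ufun u)) t r := fun t r hp =>
    wave_equation_Ufun hΩ hu (hpde t (Ioo_subset_Icc_self hp.1) r hp.2) hp.2 hp
  have hcone : ∀ t ∈ Icc (t₀ - T) t₀, ∀ r, |t - r| ≤ R →
      (t, r) ∈ Ioo 0 Tb ×ˢ Ioi (0 : ℝ) ∧ ConeBounds u C ε t r := by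
    intro t ht r hr
    have ht' : t ∈ Ioo 0 Tb := ⟨by linarith [ht.1], by linarith [ht.2]⟩
    refine ⟨⟨ht', ?_⟩, ?_⟩
    · change 0 < r
      linarith [(abs_le.1 hr).2, ht.1]
    · rw [hC]
      exact coneBounds_of_estimates hCb hε ht'.1.le hr
        (fun α hα => hest α hα t (Ioo_subset_Icc_self ht') r)
        (fun α hα => hest' α hα t (Ioo_subset_Icc_self ht') r)
  have hcurve : ∀ γ : ℝ → ℝ, (∀ t ∈ Icc 0 Tb, HasDerivAt γ (cfun u t (γ t)) t) →
      |γ 0| ≤ |ρ₀| + M + 1 → |t₀ - γ t₀| ≤ Q := by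
    intro γ hγ hγ0
    have h := abs_sub_le_of_deriv_near_one (γ := γ) (K := 2 * (Cb * ε)) (by positivity) ht0.le
      (fun s hs => hγ s ⟨hs.1, by linarith [hs.2]⟩) (fun s hs => ?_) hγ0
    · rwa [show 2 * (Cb * ε) * t₀ = 2 * Cb by rw [ht₀]; field_simp, ← hQ] at h
    · have hs' : s ∈ Icc 0 Tb := ⟨hs.1, by linarith [hs.2]⟩
      have hw : Cb * ε * (1 + s)⁻¹ ≤ Cb * ε :=
        mul_le_of_le_one_right (by positivity) (inv_le_one_of_one_le₀ (by linarith [hs.1]))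
      have ha := abs_nonneg (s - γ s)
      have hs1 : Real.sqrt (1 + |s - γ s|) ≤ 1 + |s - γ s| :=
        Real.sqrt_le_iff.2 ⟨by linarith, by nlinarith⟩
      have hs2 : (Real.sqrt (1 + |s - γ s|))⁻¹ ≤ 1 + |s - γ s| :=
        (inv_le_one_of_one_le₀ (Real.one_le_sqrt.2 (by linarith))).trans (by linarith)
      have h1 : |u s (γ s)| ≤ Cb * ε * (1 + |s - γ s|) :=
        (hest [] (by simp) s hs' (γ s)).trans
          (mul_le_mul hw hs1 (Real.sqrt_nonneg _) (by positivity))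
      have h2 : |Pt u s (γ s)| ≤ Cb * ε * (1 + |s - γ s|) :=
        (hest' [] (by simp) s hs' (γ s)).1.trans (mul_le_mul hw hs2 (by positivity) (by positivity))
      have := abs_cfun_sub_one_le h1 h2
      linarith
  have hloQ : |t₀ - rlo t₀| ≤ Q := hcurve rlo (fun t ht => (hchar t ht).1) (by
    rw [hlo]
    have h1 := neg_abs_le ρ₀
    have h2 := le_abs_self ρ₀
    rw [abs_le]
    constructor <;> linarith)
  have hhiQ : |t₀ - rhi t₀| ≤ Q := hcurve rhi (fun t ht => (hchar t ht).2) (by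
    rw [hhi, abs_of_pos hM]
    linarith [abs_nonneg ρ₀])
  have hD : ∀ r ∈ Icc (rlo t₀) (rhi t₀), |t₀ - r| ≤ Q := fun r hr => by
    rw [abs_le] at *
    constructor <;> linarith [hr.1, hr.2, hloQ.1, hloQ.2, hhiQ.1, hhiQ.2]
  have hDb : ∀ r ∈ Icc (rlo t₀) (rhi t₀), 1 ≤ r ∧ |t₀ - r| ≤ R ∧
      (t₀, r) ∈ Ioo 0 Tb ×ˢ Ioi (0 : ℝ) ∧ ConeBounds u C ε t₀ r := fun r hr => by
    have h := hD r hr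
    have hr' : |t₀ - r| ≤ R := by linarith
    exact ⟨by linarith [(abs_le.1 h).2], hr', hcone t₀ ⟨by linarith, le_rfl⟩ r hr'⟩
  have hsup : ∀ (g : ℝ × ℝ → ℝ) (B : ℝ), 0 ≤ B →
      (∀ r ∈ Icc (rlo t₀) (rhi t₀), g (t₀, r) ≤ B) →
      sSup (g '' {p : ℝ × ℝ | p.1 ∈ Icc t₀ t₀ ∧ p.2 ∈ Icc (rlo p.1) (rhi p.1)}) ≤ B := by
    intro g B hB hg
    refine Real.sSup_le ?_ hB
    rintro _ ⟨⟨t, r⟩, ⟨ht, hr⟩, rfl⟩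
    obtain rfl : t = t₀ := le_antisymm ht.2 ht.1
    exact hg r hr
  have hEε : 0 < E * ε := by positivity
  refine ⟨?_, ?_, ?_, ?_⟩
  · rw [Afun, ← ht₀, Icc_self, image_singleton, csSup_singleton]
    have h := norm_setIntegral_le_of_norm_le_const (μ := volume) (f := fun r => |w1 u t₀ r|)
      (s := Icc (rlo t₀) (rhi t₀)) (C := 3 * ((R + 2) * C * ε)) measure_Icc_lt_top
      (fun r hr => by
        obtain ⟨h1, h2, h3, h4⟩ := hDb r hr
        rw [Real.norm_eq_abs, abs_abs]
        exact h4.abs_w1_le hΩ hu h3 hC0 hε ht0.le (by linarith) h2 hsmall)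
    have hvol : volume.real (Icc (rlo t₀) (rhi t₀)) ≤ 2 * Q := by
      rw [Real.volume_real_Icc]
      exact max_le (by linarith [(abs_le.1 hloQ).2, (abs_le.1 hhiQ).1]) (by linarith)
    calc _ ≤ 3 * ((R + 2) * C * ε) * volume.real (Icc (rlo t₀) (rhi t₀)) :=
          (le_abs_self _).trans h
      _ ≤ 3 * ((R + 2) * C * ε) * (2 * Q) := by gcongr
      _ = 12 * ((R + 2) * C) * Q * ε / 2 := by ring
      _ ≤ E * ε / 2 := by gcongr
  · rw [Bfun, ← ht₀]
    refine hsup _ _ hEε.le fun r hr => ?_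
    obtain ⟨-, -, -, h4⟩ := hDb r hr
    calc t₀ * |Pt u t₀ r| ≤ t₀ * (C * ε / (1 + t₀)) := by gcongr; exact h4.pt
      _ ≤ C * ε := by rw [mul_div_assoc', div_le_iff₀ (by linarith)]; nlinarith [mul_pos hC0 hε]
      _ ≤ E * ε := by gcongr
  · rw [Cfun, ← ht₀]
    refine hsup _ _ (mul_nonneg (sq_nonneg _) (sq_nonneg _)) fun r hr => ?_
    refine rpow_three_halves_mul_le ht1 (abs_nonneg _) ?_
    have hvac : IsOpen {p : ℝ × ℝ | p.1 ∈ Ioo 0 Tb ∧ p.1 + M < p.2} :=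
      (isOpen_Ioo.preimage continuous_fst).inter
        (isOpen_lt (continuous_fst.add continuous_const) continuous_snd)
    refine (abs_w2_le hΩ hu hwave hM hC0 hε hε1 hsmall (hD r hr) hT hR hlarge hK
      ⟨_, hvac, fun t r hp => hsupp t (Ioo_subset_Icc_self hp.1) r hp.2,
        fun r hr => ⟨⟨by linarith, by linarith⟩, hr⟩⟩ hcone).trans ?_
    gcongr
  · rw [Dfun, ← ht₀]
    refine hsup _ _ hEε.le fun r hr => ?_
    obtain ⟨h1, h2, h3, h4⟩ := hDb r hr
    refine rpow_three_halves_mul_le ht1 (abs_nonneg _) ?_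
    refine (abs_L1op_le h4 hC0 hε hε1 ht0.le (by linarith) h4.pr h4.scaling h4.rotation).trans ?_
    gcongr
    linarith
end
end
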